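/- Let X be a Polish, locally compact Hausdorff space, and let k : X × X → ℝ be a bounded continuous symmetric positive semidefinite kernel with 0 ≤ k(·,·) ≤ K for some K > 0, such that the MMD d_k is a metric on P(X) metrizing weak convergence. Let P, Q be Borel probability measures on X, m = m(n) with m(n)/n → ∞, y_1,…,y_m i.i.d. P, independently x_1,…,x_n i.i.d. Q, α ∈ (0,1), and γ_{m,n} = (sqrt(K/m) + sqrt(K/n))·(2 + sqrt(2·log(2/α))). Define the unbiased two-sample statistic d_u²(P̂_m, Q̂_n) = (1/(m(m−1)))∑_{i≠j} k(y_i,y_j) + (1/(n(n−1)))∑_{i≠j} k(x_i,x_j) − (2/(mn))∑_{i=1}^n ∑_{j=1}^m k(x_i,y_j). Then: (1) if Q = P, for all m, n ≥ 2, Prob(d_u²(P̂_m, Q̂_n) > γ_{m,n}² + K/m + K/n) ≤ α; and (2) if 0 < D(P‖Q) < ∞, then liminf_{n→∞} −(1/n) log Prob(d_u²(P̂_m, Q̂_n) ≤ γ_{m,n}² + K/m + K/n) = D(P‖Q). -/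

import Mathlib

open MeasureTheory Filter Topology ENNReal
open scoped Classical

noncomputable section
/-- The Kullback-Leibler divergence `D(P‖Q) ∈ [0,∞]`: it equals `∫ log (dP/dQ) dP` when
`P ≪ Q` (and the integral is well defined), and `+∞` otherwise. -/
def klDiv {X : Type*} [MeasurableSpace X] (P Q : Measure X) : ℝ≥0∞ :=
  if P ≪ Q ∧ Integrable (llr P Q) P then ENNReal.ofReal (∫ x, llr P Q x ∂P) else ⊤
/-- The empirical measure `(1/n) ∑_{i<n} δ_{x i}` of a sample, as a probability measure
(junk value for `n = 0`). -/
def empMeas {X : Type*} [MeasurableSpace X] [Nonempty X] (n : ℕ) (x : Fin n → X) :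
    ProbabilityMeasure X :=
  if h : 0 < n then
    ⟨(n : ℝ≥0∞)⁻¹ • ∑ i, Measure.dirac (x i), by
      constructor
      simp only [Measure.smul_apply, smul_eq_mul, Measure.coe_finset_sum, Finset.sum_apply,
        measure_univ, Finset.sum_const, Finset.card_univ, Fintype.card_fin, nsmul_eq_mul, mul_one]
      exact ENNReal.inv_mul_cancel (by exact_mod_cast h.ne') (by simp)⟩
  else ⟨Measure.dirac (Classical.arbitrary X), inferInstance⟩
/-- The squared Maximum Mean Discrepancy associated with the kernel `k`. -/
def mmdSq {X : Type*} [MeasurableSpace X] (k : X → X → ℝ) (P Q : Measure X) : ℝ :=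
  (∫ y, ∫ y', k y y' ∂P ∂P) + (∫ x, ∫ x', k x x' ∂Q ∂Q) - 2 * ∫ y, ∫ x, k y x ∂Q ∂P

/-- The Maximum Mean Discrepancy `d_k`, the nonnegative square root of `mmdSq`. -/
def mmd {X : Type*} [MeasurableSpace X] (k : X → X → ℝ) (P Q : Measure X) : ℝ :=
  Real.sqrt (mmdSq k P Q)
/-- The exponential decay rate `-(1/n) log p` of a probability `p`, valued in `EReal`
(with `-(1/n) log 0 = ⊤`). -/
def expRate (n : ℕ) (p : ℝ≥0∞) : EReal := -((((n : ℝ)⁻¹ : ℝ) : EReal) * ENNReal.log p)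

/-- The unbiased two-sample estimator `d_u²(P̂_m, Q̂_n)` of the squared MMD. -/
def duSqTwo {X : Type*} (k : X → X → ℝ) {m n : ℕ} (y : Fin m → X) (x : Fin n → X) : ℝ :=
  ((m : ℝ) * ((m : ℝ) - 1))⁻¹ *
      ∑ i, ∑ j ∈ Finset.univ.filter (fun j => j ≠ i), k (y i) (y j)
    + ((n : ℝ) * ((n : ℝ) - 1))⁻¹ *
      ∑ i, ∑ j ∈ Finset.univ.filter (fun j => j ≠ i), k (x i) (x j)
    - (2 / ((m : ℝ) * (n : ℝ))) * ∑ i, ∑ j, k (x i) (y j)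

open ProbabilityTheory in
/-- **McDiarmid's inequality** in sub-Gaussian form, for i.i.d. coordinates with a common
difference bound `c`. -/
theorem hasSubgaussianMGF_of_bounded_differences {X : Type*} [MeasurableSpace X] (P : Measure X)
    [IsProbabilityMeasure P] (c : NNReal) (N : ℕ) (f : (Fin N → X) → ℝ) (hf : Measurable f)
    (B : ℝ) (hB : ∀ x, |f x| ≤ B)
    (hc : ∀ x i a, |f (Function.update x i a) - f x| ≤ c) :
    HasSubgaussianMGF (fun x => f x - ∫ y, f y ∂(Measure.pi fun _ => P)) (N * (c / 2) ^ 2)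
      (Measure.pi fun _ : Fin N => P) := by
  have hX : Nonempty X := nonempty_of_isProbabilityMeasure P
  induction N with
  | zero =>
    have h0 : ∀ x : Fin 0 → X, f x - ∫ y, f y ∂(Measure.pi fun _ => P) = 0 := by
      intro x
      have : ∀ y, f y = f x := fun y => by rw [Subsingleton.elim y x]
      simp [this]
    constructor
    · simp [h0]
    · intro t
      simp [h0, mgf]
  | succ n ih =>
    set μ : Measure (Fin n → X) := Measure.pi fun _ => P
    have hmp := measurePreserving_piFinSuccAbove (fun _ : Fin (n + 1) => P) 0
    set F : X → (Fin n → X) → ℝ := fun a w => f (Fin.insertNth (α := fun _ => X) 0 a w) with hF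
    have hFm : Measurable (Function.uncurry F) :=
      hf.comp (MeasurableEquiv.piFinSuccAbove (fun _ : Fin (n + 1) => X) 0).symm.measurable
    have hFB : ∀ a w, |F a w| ≤ B := fun a w => hB _
    have hFma : ∀ a, Measurable (F a) := fun a => hFm.comp (measurable_const.prodMk measurable_id)
    have hFi : ∀ a, Integrable (F a) μ := fun a =>
      Integrable.of_bound (hFma a).aestronglyMeasurable B (.of_forall fun w => hFB a w)
    set g : X → ℝ := fun a => ∫ w, F a w ∂μ with hg
    have hgm : Measurable g := (hFm.stronglyMeasurable.integral_prod_right).measurable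
    have hgB : ∀ a, |g a| ≤ B := fun a => by
      simpa using norm_integral_le_of_norm_le_const (μ := μ) (f := F a)
        (.of_forall fun w => hFB a w)
    have hgc : ∀ a b, g a - g b ≤ c := by
      intro a b
      rw [hg]
      simp only
      rw [← integral_sub (hFi a) (hFi b)]
      calc ∫ w, (F a w - F b w) ∂μ ≤ ∫ w, (c : ℝ) ∂μ := by
            refine integral_mono ((hFi a).sub (hFi b)) (integrable_const _) fun w => ?_
            have := hc (Fin.insertNth (α := fun _ => X) 0 b w) 0 a
            rw [Fin.insertNth_zero', Fin.update_cons_zero] at this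
            simpa [hF] using (le_abs_self _).trans this
        _ = c := by simp
    have hbdd : BddBelow (Set.range g) := ⟨-B, by
      rintro _ ⟨a, rfl⟩
      exact (abs_le.1 (hgB a)).1⟩
    have hgsub := hasSubgaussianMGF_of_mem_Icc (μ := P) (X := g) (a := ⨅ a, g a)
      (b := (⨅ a, g a) + c) hgm.aemeasurable (.of_forall fun a => ⟨ciInf_le hbdd a, by
        have : g a - c ≤ ⨅ b, g b := le_ciInf fun b => by linarith [hgc a b]
        linarith⟩)
    have hFsub : ∀ a, HasSubgaussianMGF (fun w => F a w - g a) (n * (c / 2) ^ 2) μ := by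
      intro a
      refine ih (F a) (hFma a) (hFB a) fun w i b => ?_
      have := hc (Fin.insertNth (α := fun _ => X) 0 a w) i.succ b
      rw [Fin.insertNth_zero', ← Fin.cons_update] at this
      simpa [hF] using this
    have hE : ∫ y, f y ∂(Measure.pi fun _ : Fin (n + 1) => P) = ∫ a, g a ∂P := by
      rw [← hmp.symm.integral_comp (MeasurableEquiv.measurableEmbedding _), hg]
      exact integral_prod _ (Integrable.of_bound hFm.aestronglyMeasurable B
        (.of_forall fun p => hFB p.1 p.2))
    set E := ∫ y, f y ∂(Measure.pi fun _ : Fin (n + 1) => P)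
    have hexp_int : ∀ t : ℝ, Integrable (fun x => Real.exp (t * (f x - E)))
        (Measure.pi fun _ : Fin (n + 1) => P) := by
      intro t
      refine Integrable.of_bound (by fun_prop) (Real.exp (|t| * (B + |E|))) (.of_forall fun x => ?_)
      rw [Real.norm_eq_abs, Real.abs_exp]
      refine Real.exp_le_exp.2 ((le_abs_self _).trans ?_)
      rw [abs_mul]
      gcongr
      exact (abs_sub _ _).trans (by gcongr; exact hB x)
    refine ⟨hexp_int, fun t => ?_⟩
    have hmgf : mgf (fun x => f x - E) (Measure.pi fun _ : Fin (n + 1) => P) t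
        = ∫ a, ∫ w, Real.exp (t * (F a w - E)) ∂μ ∂P := by
      rw [mgf, ← hmp.symm.integral_comp (MeasurableEquiv.measurableEmbedding _)]
      exact integral_prod _ ((hmp.symm.integrable_comp_emb
        (MeasurableEquiv.measurableEmbedding _)).2 (hexp_int t))
    rw [hmgf]
    have hgint := hgsub.integrable_exp_mul t
    rw [← hE] at hgint
    calc ∫ a, ∫ w, Real.exp (t * (F a w - E)) ∂μ ∂P
        ≤ ∫ a, Real.exp (t * (g a - E)) * Real.exp ((n * (c / 2) ^ 2) * t ^ 2 / 2) ∂P := by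
          refine integral_mono_of_nonneg (.of_forall fun a => by positivity)
            (hgint.mul_const _) (.of_forall fun a => ?_)
          have h1 : ∀ w, Real.exp (t * (F a w - E))
              = Real.exp (t * (g a - E)) * Real.exp (t * (F a w - g a)) := fun w => by
            rw [← Real.exp_add]; ring_nf
          simp only [h1, integral_const_mul]
          gcongr
          simpa [mgf] using (hFsub a).mgf_le t
      _ ≤ Real.exp (((c / 2) ^ 2) * t ^ 2 / 2) * Real.exp ((n * (c / 2) ^ 2) * t ^ 2 / 2) := by
          rw [integral_mul_const]
          gcongr
          have := hgsub.mgf_le t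
          rw [← hE] at this
          simpa [mgf] using this
      _ = _ := by
          rw [← Real.exp_add]
          push_cast
          ring_nf

/-- A continuous symmetric positive semidefinite kernel with values in `[0, K]`. -/
structure IsBddKernel {X : Type*} [TopologicalSpace X] (k : X → X → ℝ) (K : ℝ) : Prop where
  cont : Continuous fun p : X × X => k p.1 p.2
  symm : ∀ x y, k x y = k y x
  psd : ∀ (N : ℕ) (z : Fin N → X) (c : Fin N → ℝ), 0 ≤ ∑ i, ∑ j, c i * c j * k (z i) (z j)
  mem : ∀ x y, k x y ∈ Set.Icc (0 : ℝ) K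

theorem integral_empMeas {X : Type*} [MeasurableSpace X] [MeasurableSingletonClass X] [Nonempty X]
    {N : ℕ} (hN : 0 < N) (z : Fin N → X) (f : X → ℝ) :
    ∫ x, f x ∂(empMeas N z : Measure X) = (N : ℝ)⁻¹ * ∑ i, f (z i) := by
  have h : (empMeas N z : Measure X) = (N : ℝ≥0∞)⁻¹ • ∑ i, Measure.dirac (z i) := by
    simp [empMeas, hN]
  rw [h, integral_smul_measure, integral_finsetSum_measure fun i _ => integrable_dirac (by simp)]
  simp [integral_dirac]

theorem MeasureTheory.MeasurePreserving.integral_comp_measurable {Ω Ω' : Type*}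
    [MeasurableSpace Ω] [MeasurableSpace Ω'] {μ : Measure Ω} {ν : Measure Ω'} {φ : Ω → Ω'}
    (hφ : MeasurePreserving φ μ ν) {g : Ω' → ℝ} (hg : Measurable g) :
    ∫ x, g (φ x) ∂μ = ∫ y, g y ∂ν := by
  rw [← hφ.map_eq, integral_map hφ.aemeasurable hg.aestronglyMeasurable]

theorem measurePreserving_eval_pair {X : Type*} [MeasurableSpace X] (P : Measure X)
    [IsProbabilityMeasure P] {N : ℕ} {i j : Fin N} (hij : i ≠ j) :
    MeasurePreserving (fun z : Fin N → X => (z i, z j)) (Measure.pi fun _ => P) (P.prod P) := by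
  refine ⟨by fun_prop, ?_⟩
  have hind := (ProbabilityTheory.iIndepFun_pi (μ := fun _ : Fin N => P)
    (X := fun _ (x : X) => x) (fun _ => aemeasurable_id)).indepFun hij
  rw [(ProbabilityTheory.indepFun_iff_map_prod_eq_prod_map_map (measurable_pi_apply i).aemeasurable
    (measurable_pi_apply j).aemeasurable).1 hind,
    (measurePreserving_eval (fun _ : Fin N => P) i).map_eq,
    (measurePreserving_eval (fun _ : Fin N => P) j).map_eq]

theorem sum_sum_ite_eq_diag (N : ℕ) (A C : ℝ) :
    ∑ i : Fin N, ∑ j : Fin N, (if i = j then A else C) = N * A + (N ^ 2 - N) * C := by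
  have h : ∀ i j : Fin N, (if i = j then A else C) = C + if i = j then A - C else 0 := by
    intro i j
    split_ifs <;> ring
  simp only [h, Finset.sum_add_distrib]
  simp
  ring

namespace IsBddKernel

theorem norm_le {X : Type*} [TopologicalSpace X] {k : X → X → ℝ} {K : ℝ}
    (hk : IsBddKernel k K) (x y : X) : ‖k x y‖ ≤ K := by
  rw [Real.norm_eq_abs, abs_of_nonneg (hk.mem x y).1]
  exact (hk.mem x y).2

variable {X : Type*} [MeasurableSpace X] [TopologicalSpace X] {k : X → X → ℝ} {K : ℝ}

theorem norm_integral_left_le (hk : IsBddKernel k K) (ρ : Measure X) [IsProbabilityMeasure ρ]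
    (z : X) : ‖∫ y, k y z ∂ρ‖ ≤ K := by
  simpa using norm_integral_le_of_norm_le_const (μ := ρ) (.of_forall fun y => hk.norm_le y z)

theorem integral_diag_sub_le (hk : IsBddKernel k K) (P : Measure X) [IsProbabilityMeasure P] :
    (∫ z, k z z ∂P) - ∫ z, ∫ z', k z z' ∂P ∂P ≤ K := by
  have h1 : ∫ z, k z z ∂P ≤ K :=
    (le_abs_self _).trans (by
      simpa using norm_integral_le_of_norm_le_const (μ := P) (.of_forall fun y => hk.norm_le y y))
  have h2 : 0 ≤ ∫ z, ∫ z', k z z' ∂P ∂P :=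
    integral_nonneg fun z => integral_nonneg fun z' => (hk.mem z z').1
  linarith

variable [SecondCountableTopology X] [BorelSpace X]

theorem measurable_uncurry (hk : IsBddKernel k K) : Measurable fun p : X × X => k p.1 p.2 :=
  hk.cont.measurable

theorem integrable_prod (hk : IsBddKernel k K) (ρ S : Measure X) [IsProbabilityMeasure ρ]
    [IsProbabilityMeasure S] : Integrable (fun p : X × X => k p.1 p.2) (ρ.prod S) :=
  Integrable.of_bound hk.measurable_uncurry.aestronglyMeasurable K
    (.of_forall fun _ => hk.norm_le _ _)

theorem measurable_integral_left (hk : IsBddKernel k K) (ρ : Measure X) [IsProbabilityMeasure ρ] :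
    Measurable fun z => ∫ y, k y z ∂ρ :=
  (hk.measurable_uncurry.stronglyMeasurable.integral_prod_left').measurable

theorem integral_swap (hk : IsBddKernel k K) (ρ S : Measure X) [IsProbabilityMeasure ρ]
    [IsProbabilityMeasure S] : ∫ y, ∫ x, k y x ∂S ∂ρ = ∫ x, ∫ y, k y x ∂ρ ∂S :=
  integral_integral_swap (hk.integrable_prod ρ S)

theorem mmdSq_comm (hk : IsBddKernel k K) (ρ S : Measure X) [IsProbabilityMeasure ρ]
    [IsProbabilityMeasure S] : mmdSq k ρ S = mmdSq k S ρ := by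
  have h : ∫ x, ∫ y, k x y ∂ρ ∂S = ∫ x, ∫ y, k y x ∂ρ ∂S := by simp only [hk.symm]
  rw [mmdSq, mmdSq, hk.integral_swap ρ S, h]
  ring

theorem mmd_comm (hk : IsBddKernel k K) (ρ S : Measure X) [IsProbabilityMeasure ρ]
    [IsProbabilityMeasure S] : mmd k ρ S = mmd k S ρ := by
  rw [mmd, mmd, hk.mmdSq_comm]

theorem abs_mmdSq_le (hk : IsBddKernel k K) (P : Measure X) [IsProbabilityMeasure P]
    (ρ : Measure X) [IsProbabilityMeasure ρ] : |mmdSq k P ρ| ≤ 4 * K := by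
  have h : ∀ (S T : Measure X) [IsProbabilityMeasure S] [IsProbabilityMeasure T],
      |∫ y, ∫ x, k y x ∂S ∂T| ≤ K := fun S T _ _ => by
    rw [hk.integral_swap]
    simpa using norm_integral_le_of_norm_le_const (μ := S)
      (.of_forall fun y => hk.norm_integral_left_le T y)
  have h1 := abs_le.1 (h P P)
  have h2 := abs_le.1 (h ρ ρ)
  have h3 := abs_le.1 (h ρ P)
  rw [mmdSq, abs_le]
  constructor <;> linarith

variable [T2Space X] [Nonempty X]

theorem mmdSq_empMeas_right (hk : IsBddKernel k K) (ρ : Measure X) [IsProbabilityMeasure ρ]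
    {N : ℕ} (hN : 0 < N) (z : Fin N → X) :
    mmdSq k ρ (empMeas N z : Measure X) = (∫ y, ∫ y', k y y' ∂ρ ∂ρ)
      + ((N : ℝ) ^ 2)⁻¹ * ∑ i, ∑ j, k (z i) (z j) - 2 * (N : ℝ)⁻¹ * ∑ i, ∫ y, k y (z i) ∂ρ := by
  rw [mmdSq, hk.integral_swap ρ (empMeas N z : Measure X)]
  simp only [integral_empMeas hN, ← Finset.mul_sum]
  ring

theorem mmdSq_empMeas_empMeas (hk : IsBddKernel k K) {M N : ℕ} (hM : 0 < M) (hN : 0 < N)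
    (y : Fin M → X) (x : Fin N → X) :
    mmdSq k (empMeas M y : Measure X) (empMeas N x : Measure X)
      = ((M : ℝ) ^ 2)⁻¹ * ∑ i, ∑ j, k (y i) (y j) + ((N : ℝ) ^ 2)⁻¹ * ∑ i, ∑ j, k (x i) (x j)
        - 2 / ((M : ℝ) * N) * ∑ i, ∑ j, k (x i) (y j) := by
  rw [hk.mmdSq_empMeas_right _ hN]
  simp only [integral_empMeas hM, ← Finset.mul_sum]
  have : ∀ i j, k (y i) (x j) = k (x j) (y i) := fun i j => hk.symm _ _
  simp only [this]
  field_simp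

theorem mmdSq_empMeas_empMeas_nonneg (hk : IsBddKernel k K) {M N : ℕ} (hM : 0 < M) (hN : 0 < N)
    (y : Fin M → X) (x : Fin N → X) :
    0 ≤ mmdSq k (empMeas M y : Measure X) (empMeas N x : Measure X) := by
  have h := hk.psd (M + N) (Fin.append y x)
    (Fin.append (fun _ => (M : ℝ)⁻¹) (fun _ => -(N : ℝ)⁻¹))
  simp only [Fin.sum_univ_add, Fin.append_left, Fin.append_right, Finset.sum_add_distrib,
    ← Finset.mul_sum] at h
  rw [hk.mmdSq_empMeas_empMeas hM hN]
  have hs : ∑ i, ∑ j, k (y i) (x j) = ∑ i, ∑ j, k (x i) (y j) := by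
    rw [Finset.sum_comm]
    simp only [hk.symm]
  rw [hs] at h
  refine h.trans_eq ?_
  field_simp
  ring

theorem integral_mmdSq_empMeas (hk : IsBddKernel k K) (ρ P : Measure X) [IsProbabilityMeasure ρ]
    [IsProbabilityMeasure P] {N : ℕ} (hN : 0 < N) :
    ∫ z, mmdSq k ρ (empMeas N z : Measure X) ∂(Measure.pi fun _ : Fin N => P)
      = mmdSq k ρ P + (N : ℝ)⁻¹ * ((∫ z, k z z ∂P) - ∫ z, ∫ z', k z z' ∂P ∂P) := by
  simp only [hk.mmdSq_empMeas_right ρ hN]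
  have hm1 : ∀ i j, Measurable fun z : Fin N → X => k (z i) (z j) := fun i j =>
    hk.measurable_uncurry.comp (g := fun p : X × X => k p.1 p.2)
      (f := fun z : Fin N → X => (z i, z j)) (by fun_prop)
  have hi1 : ∀ i j, Integrable (fun z : Fin N → X => k (z i) (z j)) (Measure.pi fun _ => P) :=
    fun i j => Integrable.of_bound (hm1 i j).aestronglyMeasurable K
      (.of_forall fun p => hk.norm_le _ _)
  have hi2 : ∀ i, Integrable (fun z : Fin N → X => ∫ y, k y (z i) ∂ρ) (Measure.pi fun _ => P) :=
    fun i => Integrable.of_bound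
      ((hk.measurable_integral_left ρ).comp (measurable_pi_apply i)).aestronglyMeasurable K
      (.of_forall fun p => hk.norm_integral_left_le ρ _)
  have hv1 : ∀ i j : Fin N, ∫ z : Fin N → X, k (z i) (z j) ∂(Measure.pi fun _ => P)
      = if i = j then ∫ z, k z z ∂P else ∫ z, ∫ z', k z z' ∂P ∂P := by
    intro i j
    split_ifs with hij
    · subst hij
      have hd : Measurable fun z : X => k z z :=
        hk.measurable_uncurry.comp (measurable_id.prodMk measurable_id)
      exact (measurePreserving_eval (fun _ : Fin N => P) i).integral_comp_measurable hd
    · rw [← integral_prod _ (hk.integrable_prod P P)]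
      exact (measurePreserving_eval_pair P hij).integral_comp_measurable hk.measurable_uncurry
  have hv2 : ∀ i : Fin N, ∫ z : Fin N → X, ∫ y, k y (z i) ∂ρ ∂(Measure.pi fun _ => P)
      = ∫ y, ∫ x, k y x ∂P ∂ρ := by
    intro i
    rw [hk.integral_swap]
    exact (measurePreserving_eval (fun _ : Fin N => P) i).integral_comp_measurable
      (hk.measurable_integral_left ρ)
  rw [integral_sub, integral_add (integrable_const _), integral_const_mul, integral_const_mul,
    integral_finsetSum, integral_finsetSum _ fun i _ => hi2 i]
  · simp only [integral_finsetSum _ fun j _ => hi1 _ j, hv1, hv2, sum_sum_ite_eq_diag]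
    simp only [integral_const, probReal_univ, Finset.sum_const, Finset.card_univ,
      Fintype.card_fin, smul_eq_mul, nsmul_eq_mul, mmdSq]
    field_simp
    ring
  · exact fun i _ => integrable_finsetSum _ fun j _ => hi1 i j
  · exact (integrable_finsetSum _ fun i _ => integrable_finsetSum _ fun j _ => hi1 i j).const_mul _
  · exact (integrable_const _).add
      ((integrable_finsetSum _ fun i _ => integrable_finsetSum _ fun j _ => hi1 i j).const_mul _)
  · exact (integrable_finsetSum _ fun i _ => hi2 i).const_mul _

theorem mmdSq_empMeas_nonneg (hk : IsBddKernel k K) (P : Measure X) [IsProbabilityMeasure P]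
    {M : ℕ} (hM : 0 < M) (y : Fin M → X) : 0 ≤ mmdSq k P (empMeas M y : Measure X) := by
  rw [hk.mmdSq_comm]
  have hlim : Tendsto (fun N : ℕ => -((N : ℝ)⁻¹ * K)) atTop (𝓝 0) := by
    simpa using (tendsto_inv_atTop_nhds_zero_nat.mul_const K).neg
  refine le_of_tendsto hlim ?_
  filter_upwards [eventually_gt_atTop 0] with N hN
  have h1 := hk.integral_mmdSq_empMeas (empMeas M y : Measure X) P hN
  have h2 : 0 ≤ ∫ z, mmdSq k (empMeas M y : Measure X) (empMeas N z : Measure X)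
      ∂(Measure.pi fun _ : Fin N => P) :=
    integral_nonneg fun z => hk.mmdSq_empMeas_empMeas_nonneg hM hN y z
  have h3 : (N : ℝ)⁻¹ * ((∫ z, k z z ∂P) - ∫ z, ∫ z', k z z' ∂P ∂P) ≤ (N : ℝ)⁻¹ * K :=
    mul_le_mul_of_nonneg_left (hk.integral_diag_sub_le P) (by positivity)
  linarith

theorem measurable_mmdSq_empMeas (hk : IsBddKernel k K) (P : Measure X) [IsProbabilityMeasure P]
    {N : ℕ} (hN : 0 < N) :
    Measurable fun z : Fin N → X => mmdSq k P (empMeas N z : Measure X) := by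
  simp only [hk.mmdSq_empMeas_right P hN]
  have hm1 : ∀ i j, Measurable fun z : Fin N → X => k (z i) (z j) := fun i j =>
    hk.measurable_uncurry.comp (g := fun p : X × X => k p.1 p.2)
      (f := fun z : Fin N → X => (z i, z j)) (by fun_prop)
  have hm2 : ∀ i, Measurable fun z : Fin N → X => ∫ y, k y (z i) ∂P := fun i =>
    (hk.measurable_integral_left P).comp (measurable_pi_apply i)
  exact (((Finset.measurable_fun_sum _ fun i _ => Finset.measurable_fun_sum _ fun j _ =>
    hm1 i j).const_mul _).const_add _).sub ((Finset.measurable_fun_sum _ fun i _ =>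
    hm2 i).const_mul _)

theorem integral_mmd_empMeas_le (hk : IsBddKernel k K) (P : Measure X) [IsProbabilityMeasure P]
    {N : ℕ} (hN : 0 < N) :
    ∫ z, mmd k P (empMeas N z : Measure X) ∂(Measure.pi fun _ : Fin N => P)
      ≤ Real.sqrt (K / N) := by
  have hm := (hk.measurable_mmdSq_empMeas P hN)
  have hmem : MemLp (fun z : Fin N → X => mmd k P (empMeas N z : Measure X)) 2
      (Measure.pi fun _ : Fin N => P) := by
    refine MemLp.of_bound (C := Real.sqrt (4 * K))
      (Real.continuous_sqrt.measurable.comp hm).aestronglyMeasurable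
      (.of_forall fun z => ?_)
    rw [Real.norm_eq_abs, mmd, abs_of_nonneg (Real.sqrt_nonneg _)]
    exact Real.sqrt_le_sqrt ((le_abs_self _).trans (hk.abs_mmdSq_le P _))
  refine Real.le_sqrt_of_sq_le ?_
  have hvar := ProbabilityTheory.variance_nonneg
    (fun z : Fin N → X => mmd k P (empMeas N z : Measure X)) (Measure.pi fun _ : Fin N => P)
  rw [ProbabilityTheory.variance_eq_sub hmem] at hvar
  have hsq : ∀ z : Fin N → X, mmd k P (empMeas N z : Measure X) ^ 2
      = mmdSq k P (empMeas N z : Measure X) := fun z =>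
    Real.sq_sqrt (hk.mmdSq_empMeas_nonneg P hN z)
  have hmean := hk.integral_mmdSq_empMeas P P hN
  have h0 : mmdSq k P P = 0 := by rw [mmdSq]; ring
  simp only [Pi.pow_apply, hsq, hmean, h0] at hvar
  have := mul_le_mul_of_nonneg_left (hk.integral_diag_sub_le P) (inv_nonneg.2 (Nat.cast_nonneg N))
  rw [div_eq_inv_mul]
  linarith

theorem mmd_empMeas_update_le (hk : IsBddKernel k K) {N : ℕ} (hN : 0 < N) (z : Fin N → X)
    (i : Fin N) (a : X) :
    mmd k (empMeas N (Function.update z i a) : Measure X) (empMeas N z : Measure X)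
      ≤ Real.sqrt (2 * K) / N := by
  have hNr : (0 : ℝ) < N := by exact_mod_cast hN
  rw [mmd, ← Real.sqrt_sq hNr.le, ← Real.sqrt_div' _ (sq_nonneg _)]
  refine Real.sqrt_le_sqrt ?_
  rw [hk.mmdSq_empMeas_empMeas hN hN]
  set w := Function.update z i a
  have hw : ∀ j, j ≠ i → w j = z j := fun j hj => Function.update_of_ne hj _ _
  have hs : ∑ p, ∑ q, k (z p) (w q) = ∑ p, ∑ q, k (w p) (z q) := by
    rw [Finset.sum_comm]
    simp only [hk.symm]
  have key : ∑ p, ∑ q, (k (w p) (w q) + k (z p) (z q) - k (z p) (w q) - k (w p) (z q))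
      ≤ 2 * K := by
    rw [Finset.sum_eq_single i, Finset.sum_eq_single i]
    · linarith [(hk.mem (w i) (w i)).2, (hk.mem (z i) (z i)).2, (hk.mem (z i) (w i)).1,
        (hk.mem (w i) (z i)).1]
    · intro q _ hq
      rw [hw q hq]
      ring
    · simp
    · intro p _ hp
      refine Finset.sum_eq_zero fun q _ => ?_
      rw [hw p hp]
      ring
    · simp
  simp only [Finset.sum_sub_distrib, Finset.sum_add_distrib] at key
  rw [le_div_iff₀ (by positivity)]
  refine le_trans (le_of_eq ?_) key
  rw [← hs]
  field_simp
  ring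

/-- Concentration of the empirical measure around `P` for the MMD. -/
theorem measure_mmd_empMeas_gt_le (hk : IsBddKernel k K) (hK : 0 < K)
    (h_tri : ∀ ρ S T : ProbabilityMeasure X,
      mmd k (ρ : Measure X) (T : Measure X)
        ≤ mmd k (ρ : Measure X) (S : Measure X) + mmd k (S : Measure X) (T : Measure X))
    (P : ProbabilityMeasure X) {N : ℕ} (hN : 0 < N) {t : ℝ} (ht : 0 ≤ t) :
    (Measure.pi fun _ : Fin N => (P : Measure X))
        {z | Real.sqrt (K / N) * (1 + t) ≤ mmd k (P : Measure X) (empMeas N z : Measure X)}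
      ≤ ENNReal.ofReal (Real.exp (-t ^ 2)) := by
  have hNr : (0 : ℝ) < N := by exact_mod_cast hN
  set f : (Fin N → X) → ℝ := fun z => mmd k (P : Measure X) (empMeas N z : Measure X) with hf
  have hfm : Measurable f :=
    Real.continuous_sqrt.measurable.comp (hk.measurable_mmdSq_empMeas (P : Measure X) hN)
  have hfB : ∀ z, |f z| ≤ Real.sqrt (4 * K) := fun z => by
    rw [hf]
    simp only
    rw [mmd, abs_of_nonneg (Real.sqrt_nonneg _)]
    exact Real.sqrt_le_sqrt ((le_abs_self _).trans (hk.abs_mmdSq_le _ _))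
  have hsub := hasSubgaussianMGF_of_bounded_differences (P : Measure X)
    (Real.toNNReal (Real.sqrt (2 * K) / N)) N f hfm _ hfB fun z i a => by
      rw [Real.coe_toNNReal _ (by positivity)]
      have hu := hk.mmd_empMeas_update_le hN z i a
      have hu' := hu
      rw [hk.mmd_comm] at hu'
      have h1 := h_tri P (empMeas N z) (empMeas N (Function.update z i a))
      have h2 := h_tri P (empMeas N (Function.update z i a)) (empMeas N z)
      rw [abs_le]
      constructor <;> simp only [hf] <;> linarith
  have hε : 0 ≤ Real.sqrt (K / N) * t := by positivity
  have hb := hsub.measure_ge_le hε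
  have hmean := hk.integral_mmd_empMeas_le (P : Measure X) hN
  have hexp : -(Real.sqrt (K / N) * t) ^ 2 / (2 * ((N * (Real.toNNReal (Real.sqrt (2 * K) / N) / 2)
      ^ 2 : NNReal) : ℝ)) = -t ^ 2 := by
    push_cast
    rw [Real.coe_toNNReal _ (by positivity), mul_pow, Real.sq_sqrt (by positivity), div_pow,
      div_pow, Real.sq_sqrt (by positivity)]
    field_simp
  rw [hexp] at hb
  rw [← ofReal_measureReal]
  refine ENNReal.ofReal_le_ofReal (le_trans (measureReal_mono fun z hz => ?_) hb)
  simp only [Set.mem_ofPred_eq] at hz ⊢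
  simp only [hf] at hmean ⊢
  linarith

/-- The unbiased statistic differs from the biased one by at most `K / M + K / N`. -/
theorem abs_duSqTwo_sub_mmdSq_le (hk : IsBddKernel k K) {M N : ℕ} (hM : 2 ≤ M) (hN : 2 ≤ N)
    (y : Fin M → X) (x : Fin N → X) :
    |duSqTwo k y x - mmdSq k (empMeas M y : Measure X) (empMeas N x : Measure X)|
      ≤ K / M + K / N := by
  have key : ∀ {L : ℕ} (_ : 2 ≤ L) (z : Fin L → X),
      |((L : ℝ) * ((L : ℝ) - 1))⁻¹ * ∑ i, ∑ j ∈ Finset.univ.filter (fun j => j ≠ i), k (z i) (z j)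
        - ((L : ℝ) ^ 2)⁻¹ * ∑ i, ∑ j, k (z i) (z j)| ≤ K / L := by
    intro L hL z
    have hLr : (2 : ℝ) ≤ L := by exact_mod_cast hL
    set S := ∑ i, ∑ j ∈ Finset.univ.filter (fun j => j ≠ i), k (z i) (z j)
    set D := ∑ i, k (z i) (z i)
    have hsum : ∑ i, ∑ j, k (z i) (z j) = S + D := by
      rw [← Finset.sum_add_distrib]
      refine Finset.sum_congr rfl fun i _ => ?_
      rw [Finset.filter_ne', Finset.sum_erase_add _ _ (Finset.mem_univ i)]
    have hD0 : 0 ≤ D := Finset.sum_nonneg fun i _ => (hk.mem _ _).1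
    have hD1 : D ≤ L * K := by
      refine (Finset.sum_le_sum fun i _ => (hk.mem (z i) (z i)).2).trans_eq ?_
      simp
    have hS0 : 0 ≤ S := Finset.sum_nonneg fun i _ => Finset.sum_nonneg fun j _ => (hk.mem _ _).1
    have hS1 : S ≤ L * ((L - 1) * K) := by
      refine (Finset.sum_le_sum fun i _ => Finset.sum_le_sum fun j _ =>
        (hk.mem (z i) (z j)).2).trans_eq ?_
      simp only [Finset.filter_ne', Finset.sum_const, Finset.card_erase_of_mem (Finset.mem_univ _),
        Finset.card_univ, Fintype.card_fin, nsmul_eq_mul]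
      rw [Nat.cast_sub (by omega)]
      simp
    rw [hsum]
    have e : ((L : ℝ) * ((L : ℝ) - 1))⁻¹ * S - ((L : ℝ) ^ 2)⁻¹ * (S + D)
        = (S / (L - 1) - D) / L ^ 2 := by
      have : (L : ℝ) - 1 ≠ 0 := by linarith
      field_simp
      ring
    rw [e, abs_div, abs_of_nonneg (sq_nonneg (L : ℝ)), div_le_div_iff₀ (by positivity) (by positivity)]
    have h1 : S / (L - 1) ≤ L * K := by
      rw [div_le_iff₀ (by linarith)]
      linarith
    have h2 : 0 ≤ S / ((L : ℝ) - 1) := div_nonneg hS0 (by linarith)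
    have h3 : |S / ((L : ℝ) - 1) - D| ≤ L * K := abs_le.2 ⟨by linarith, by linarith⟩
    nlinarith
  rw [hk.mmdSq_empMeas_empMeas (by omega) (by omega), duSqTwo]
  refine le_trans (le_of_eq ?_) ((abs_add_le _ _).trans (add_le_add (key hM y) (key hN x)))
  congr 1
  ring

end IsBddKernel

theorem abs_log_clip_le {f a b : ℝ} (hf : 0 < f) (ha : a ≤ 1) (hb : 1 ≤ b) :
    |Real.log (min (max f a) b)| ≤ |Real.log f| := by
  rcases le_total 1 f with h | h
  · have h1 : 1 ≤ min (max f a) b := le_min (h.trans (le_max_left _ _)) hb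
    have h2 : min (max f a) b ≤ f := (min_le_left _ _).trans (max_le le_rfl (ha.trans h))
    rw [abs_of_nonneg (Real.log_nonneg h1), abs_of_nonneg (Real.log_nonneg h)]
    exact Real.log_le_log (by linarith) h2
  · have h1 : min (max f a) b ≤ 1 := (min_le_left _ _).trans (max_le h ha)
    have h2 : f ≤ min (max f a) b := le_min (le_max_left _ _) (h.trans hb)
    rw [abs_of_nonpos (Real.log_nonpos (hf.le.trans h2) h1),
      abs_of_nonpos (Real.log_nonpos hf.le h), neg_le_neg_iff]
    exact Real.log_le_log hf h2

/-- The measurable half of the Donsker–Varadhan variational formula. -/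
theorem exists_measurable_lt_integral_sub_log {X : Type*} [MeasurableSpace X] (P Q : Measure X)
    [IsProbabilityMeasure P] [IsProbabilityMeasure Q] (hPQ : P ≪ Q)
    (hllr_int : Integrable (llr P Q) P) {r : ℝ} (hr : r < ∫ x, llr P Q x ∂P) :
    ∃ (g : X → ℝ) (B : ℝ), Measurable g ∧ (∀ x, |g x| ≤ B) ∧
      r < ∫ x, g x ∂P - Real.log (∫ x, Real.exp (g x) ∂Q) := by
  set f : X → ℝ := fun x => (P.rnDeriv Q x).toReal with hf
  have hfm : Measurable f := (Measure.measurable_rnDeriv P Q).ennreal_toReal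
  have hf0 : ∀ x, 0 ≤ f x := fun x => ENNReal.toReal_nonneg
  have hfi : Integrable f Q := Measure.integrable_toReal_rnDeriv
  have hf1 : ∫ x, f x ∂Q = 1 := by
    rw [hf, Measure.integral_toReal_rnDeriv hPQ]
    simp
  set φ : ℕ → X → ℝ := fun N x => min (max (f x) ((N : ℝ) + 1)⁻¹) ((N : ℝ) + 1) with hφ
  have hφm : ∀ N, Measurable (φ N) := fun N => by
    rw [hφ]
    fun_prop
  have hinv : ∀ N : ℕ, ((N : ℝ) + 1)⁻¹ ≤ 1 := fun N => inv_le_one_of_one_le₀ (by simp)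
  have hφlow : ∀ (N : ℕ) x, ((N : ℝ) + 1)⁻¹ ≤ φ N x := fun N x =>
    le_min (le_max_right _ _) ((hinv N).trans (by simp))
  have hφpos : ∀ (N : ℕ) x, 0 < φ N x := fun N x => lt_of_lt_of_le (by positivity) (hφlow N x)
  have hφlim : ∀ x, Tendsto (fun N => φ N x) atTop (𝓝 (f x)) := by
    intro x
    have h1 : Tendsto (fun N : ℕ => max (f x) ((N : ℝ) + 1)⁻¹) atTop (𝓝 (f x)) := by
      have h : Tendsto (fun N : ℕ => ((N : ℝ) + 1)⁻¹) atTop (𝓝 0) := by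
        simpa using tendsto_one_div_add_atTop_nhds_zero_nat (𝕜 := ℝ)
      simpa [hf0 x] using (tendsto_const_nhds (x := f x)).max h
    refine h1.congr' ?_
    filter_upwards [eventually_ge_atTop ⌈f x⌉₊] with N hN
    rw [hφ]
    simp only
    rw [min_eq_left]
    exact max_le (by linarith [Nat.ceil_le.1 hN]) ((hinv N).trans (by simp))
  have hlim1 : Tendsto (fun N => ∫ x, Real.log (φ N x) ∂P) atTop (𝓝 (∫ x, llr P Q x ∂P)) := by
    have hpos : ∀ᵐ x ∂P, 0 < f x := by
      filter_upwards [Measure.rnDeriv_pos hPQ, hPQ.ae_le (Measure.rnDeriv_lt_top P Q)] with x h1 h2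
      exact ENNReal.toReal_pos h1.ne' h2.ne
    refine tendsto_integral_of_dominated_convergence (fun x => |llr P Q x|)
      (fun N => (hφm N).log.aestronglyMeasurable) hllr_int.abs (fun N => ?_) ?_
    · filter_upwards [hpos] with x hx
      exact abs_log_clip_le hx (hinv N) (by simp)
    · filter_upwards [hpos] with x hx
      exact ((Real.continuousAt_log hx.ne').tendsto.comp (hφlim x))
  have hlim2 : Tendsto (fun N => ∫ x, φ N x ∂Q) atTop (𝓝 1) := by
    rw [← hf1]
    refine tendsto_integral_of_dominated_convergence (fun x => f x + 1)
      (fun N => (hφm N).aestronglyMeasurable) (hfi.add (integrable_const _))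
      (fun N => .of_forall fun x => ?_) (.of_forall hφlim)
    rw [Real.norm_eq_abs, abs_of_pos (hφpos N x)]
    exact (min_le_left _ _).trans (max_le (by linarith) ((hinv N).trans (by linarith [hf0 x])))
  have hlim := hlim1.sub ((Real.continuousAt_log one_ne_zero).tendsto.comp hlim2)
  rw [Real.log_one, sub_zero] at hlim
  obtain ⟨N, hN⟩ := (hlim.eventually (lt_mem_nhds hr)).exists
  refine ⟨fun x => Real.log (φ N x), Real.log ((N : ℝ) + 1), (hφm N).log, fun x => ?_, ?_⟩
  · rw [abs_le, ← Real.log_inv]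
    exact ⟨Real.log_le_log (by positivity) (hφlow N x),
      Real.log_le_log (hφpos N x) (min_le_right _ _)⟩
  · simpa [Real.exp_log (hφpos N _)] using hN

theorem abs_exp_sub_exp_le {a b B : ℝ} (ha : a ≤ B) (hb : b ≤ B) :
    |Real.exp a - Real.exp b| ≤ Real.exp B * |a - b| := by
  have key : ∀ {a b : ℝ}, a ≤ B → b ≤ a →
      |Real.exp a - Real.exp b| ≤ Real.exp B * |a - b| := by
    intro a b ha hba
    rw [abs_of_nonneg (sub_nonneg.2 (Real.exp_le_exp.2 hba)), abs_of_nonneg (sub_nonneg.2 hba)]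
    have h1 : Real.exp b = Real.exp a * Real.exp (b - a) := by rw [← Real.exp_add]; ring_nf
    have h2 := Real.add_one_le_exp (b - a)
    have h3 := Real.exp_le_exp.2 ha
    have h4 := Real.exp_pos a
    nlinarith
  rcases le_total b a with h | h
  · exact key ha h
  · rw [abs_sub_comm, abs_sub_comm a]
    exact key hb h

/-- A half of the Donsker–Varadhan variational formula, with bounded continuous functions. -/
theorem exists_boundedContinuous_lt_integral_sub_log {X : Type*} [MeasurableSpace X]
    [TopologicalSpace X] [PolishSpace X] [BorelSpace X] (P Q : Measure X)
    [IsProbabilityMeasure P] [IsProbabilityMeasure Q] (hPQ : P ≪ Q)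
    (hllr_int : Integrable (llr P Q) P) {r : ℝ} (hr : r < ∫ x, llr P Q x ∂P) :
    ∃ g : BoundedContinuousFunction X ℝ,
      r < ∫ x, g x ∂P - Real.log (∫ x, Real.exp (g x) ∂Q) := by
  let _ := TopologicalSpace.upgradeIsCompletelyMetrizable X
  obtain ⟨g, B, hgm, hgB, hg⟩ := exists_measurable_lt_integral_sub_log P Q hPQ hllr_int hr
  have hbdd_int : ∀ (h : X → ℝ) (μ : Measure X) [IsFiniteMeasure μ], Measurable h →
      (∀ x, |h x| ≤ B) → Integrable h μ := fun h μ _ hm hb =>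
    Integrable.of_bound hm.aestronglyMeasurable B (.of_forall hb)
  have hexpint : ∀ (h : X → ℝ), Measurable h → (∀ x, |h x| ≤ B) →
      Integrable (fun x => Real.exp (h x)) Q := fun h hm hb =>
    Integrable.of_bound hm.exp.aestronglyMeasurable (Real.exp B) (.of_forall fun x => by
      rw [Real.norm_eq_abs, Real.abs_exp]
      exact Real.exp_le_exp.2 (abs_le.1 (hb x)).2)
  have happrox : ∀ n : ℕ, ∃ h : BoundedContinuousFunction X ℝ, (∀ x, |h x| ≤ B) ∧
      ∫ x, |h x - g x| ∂(P + Q) ≤ 1 / ((n : ℝ) + 1) := by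
    intro n
    obtain ⟨h, hh, hhi⟩ := (hbdd_int g (P + Q) hgm hgB).exists_boundedContinuous_integral_sub_le
      (ε := 1 / ((n : ℝ) + 1)) (by positivity)
    have hB : ∀ x, |max (min (h x) B) (-B)| ≤ B := fun x => by
      have : 0 ≤ B := (abs_nonneg _).trans (hgB x)
      exact abs_le.2 ⟨le_max_right _ _, max_le (min_le_right _ _) (by linarith)⟩
    refine ⟨BoundedContinuousFunction.ofNormedAddCommGroup (fun x => max (min (h x) B) (-B))
      (by fun_prop) B hB, hB, le_trans ?_ hh⟩
    have hi1 := hbdd_int g (P + Q) hgm hgB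
    have hi2 := hbdd_int (fun x => max (min (h x) B) (-B)) (P + Q) (by fun_prop) hB
    refine integral_mono (hi2.sub hi1).abs (hi1.sub hhi).norm fun x => ?_
    simp only [BoundedContinuousFunction.coe_ofNormedAddCommGroup, Real.norm_eq_abs]
    have h1 := abs_le.1 (hgB x)
    rw [abs_sub_comm (g x)]
    have e : g x = max (min (g x) B) (-B) := by rw [min_eq_left h1.2, max_eq_left h1.1]
    conv_lhs => rw [e]
    exact (abs_max_sub_max_le_abs _ _ _).trans (abs_inf_sub_inf_le_abs _ _ _)
  choose h hhB hh using happrox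
  have hhm : ∀ n, Measurable (h n) := fun n => (h n).continuous.measurable
  have hdiff : ∀ n (μ : Measure X) [IsFiniteMeasure μ], Integrable (fun x => |h n x - g x|) μ :=
    fun n μ _ => ((hbdd_int _ μ (hhm n) (hhB n)).sub (hbdd_int _ μ hgm hgB)).abs
  have h0 : Tendsto (fun n : ℕ => 1 / ((n : ℝ) + 1)) atTop (𝓝 0) :=
    tendsto_one_div_add_atTop_nhds_zero_nat
  have hsplit : ∀ n, ∫ x, |h n x - g x| ∂P ≤ 1 / ((n : ℝ) + 1)
      ∧ ∫ x, |h n x - g x| ∂Q ≤ 1 / ((n : ℝ) + 1) := by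
    intro n
    have := hh n
    rw [integral_add_measure (hdiff n P) (hdiff n Q)] at this
    have h1 : 0 ≤ ∫ x, |h n x - g x| ∂P := integral_nonneg fun x => abs_nonneg _
    have h2 : 0 ≤ ∫ x, |h n x - g x| ∂Q := integral_nonneg fun x => abs_nonneg _
    constructor <;> linarith
  have hl1 : Tendsto (fun n => ∫ x, h n x ∂P) atTop (𝓝 (∫ x, g x ∂P)) := by
    refine tendsto_iff_norm_sub_tendsto_zero.2 (squeeze_zero (fun n => norm_nonneg _)
      (fun n => ?_) h0)
    rw [← integral_sub (hbdd_int _ P (hhm n) (hhB n)) (hbdd_int _ P hgm hgB)]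
    exact (norm_integral_le_integral_norm _).trans (hsplit n).1
  have h0' : Tendsto (fun n : ℕ => Real.exp B * (1 / ((n : ℝ) + 1))) atTop (𝓝 0) := by
    have := h0.const_mul (Real.exp B)
    rwa [mul_zero] at this
  have hl2 : Tendsto (fun n => ∫ x, Real.exp (h n x) ∂Q) atTop (𝓝 (∫ x, Real.exp (g x) ∂Q)) := by
    refine tendsto_iff_norm_sub_tendsto_zero.2 (squeeze_zero (fun n => norm_nonneg _)
      (fun n => ?_) h0')
    rw [← integral_sub (hexpint _ (hhm n) (hhB n)) (hexpint _ hgm hgB)]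
    refine (norm_integral_le_integral_norm _).trans ?_
    refine le_trans ?_ (mul_le_mul_of_nonneg_left (hsplit n).2 (Real.exp_pos B).le)
    rw [← integral_const_mul]
    exact integral_mono_of_nonneg (.of_forall fun x => norm_nonneg _)
      ((hdiff n Q).const_mul _) (.of_forall fun x =>
        abs_exp_sub_exp_le (abs_le.1 (hhB n x)).2 (abs_le.1 (hgB x)).2)
  have hpos : 0 < ∫ x, Real.exp (g x) ∂Q := integral_exp_pos (hexpint g hgm hgB)
  have hl := hl1.sub ((Real.continuousAt_log hpos.ne').tendsto.comp hl2)
  obtain ⟨n, hn⟩ := (hl.eventually (lt_mem_nhds hg)).exists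
  exact ⟨h n, hn⟩

/-- The exponential Chebyshev inequality for sums over an i.i.d. sample. -/
theorem measure_pi_le_sum_le {X : Type*} [MeasurableSpace X] (Q : Measure X)
    [IsProbabilityMeasure Q] (g : X → ℝ) (hg : Integrable (fun x => Real.exp (g x)) Q)
    (n : ℕ) (c : ℝ) :
    (Measure.pi fun _ : Fin n => Q) {x | n * c ≤ ∑ i, g (x i)}
      ≤ ENNReal.ofReal (Real.exp (-(n * (c - Real.log (∫ x, Real.exp (g x) ∂Q))))) := by
  have hexp : ∀ x : Fin n → X, Real.exp (1 * ∑ i, g (x i)) = ∏ i, Real.exp (g (x i)) := fun x => by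
    rw [one_mul, Real.exp_sum]
  have hpos : 0 < ∫ x, Real.exp (g x) ∂Q := integral_exp_pos hg
  have h := ProbabilityTheory.measure_ge_le_exp_mul_mgf (μ := Measure.pi fun _ : Fin n => Q)
    (X := fun x => ∑ i, g (x i)) (n * c) zero_le_one (by
      simp only [hexp]
      exact Integrable.fintype_prod fun _ => hg)
  rw [← ofReal_measureReal]
  refine ENNReal.ofReal_le_ofReal (h.trans_eq ?_)
  rw [ProbabilityTheory.mgf]
  simp only [hexp]
  rw [integral_fintype_prod_eq_pow (fun x => Real.exp (g x)), Fintype.card_fin]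
  nth_rewrite 1 [← Real.exp_log hpos]
  rw [← Real.exp_nat_mul, ← Real.exp_add]
  ring_nf

theorem MeasureTheory.Measure.pi_eq_withDensity_prod_rnDeriv {X : Type*} [MeasurableSpace X]
    (P Q : Measure X) [IsProbabilityMeasure P] [IsProbabilityMeasure Q] (hPQ : P ≪ Q) (n : ℕ) :
    (Measure.pi fun _ : Fin n => P)
      = (Measure.pi fun _ : Fin n => Q).withDensity fun x => ∏ i, P.rnDeriv Q (x i) := by
  refine Measure.pi_eq fun s hs => ?_
  rw [withDensity_apply _ (MeasurableSet.univ_pi hs), ← lintegral_indicator (.univ_pi hs)]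
  have hm : ∀ i, Measurable ((s i).indicator (P.rnDeriv Q)) := fun i =>
    (Measure.measurable_rnDeriv P Q).indicator (hs i)
  have h1 : ∀ x : Fin n → X, (Set.univ.pi s).indicator (fun x => ∏ i, P.rnDeriv Q (x i)) x
      = ∏ i, (s i).indicator (P.rnDeriv Q) (x i) := by
    intro x
    by_cases hx : x ∈ Set.univ.pi s
    · rw [Set.indicator_of_mem hx]
      exact Finset.prod_congr rfl fun i _ => (Set.indicator_of_mem (hx i trivial) _).symm
    · rw [Set.indicator_of_notMem hx]
      simp only [Set.mem_pi, Set.mem_univ, true_implies, not_forall] at hx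
      obtain ⟨i, hi⟩ := hx
      exact (Finset.prod_eq_zero (Finset.mem_univ i) (Set.indicator_of_notMem hi _)).symm
  simp only [h1]
  rw [ProbabilityTheory.lintegral_prod_eq_prod_lintegral_of_indepFun Finset.univ
    (fun i (x : Fin n → X) => (s i).indicator (P.rnDeriv Q) (x i))
    (ProbabilityTheory.iIndepFun_pi fun i => (hm i).aemeasurable)
    fun i => (hm i).comp (measurable_pi_apply i)]
  refine Finset.prod_congr rfl fun i _ => ?_
  refine ((measurePreserving_eval (fun _ : Fin n => Q) i).lintegral_comp (hm i)).trans ?_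
  rw [lintegral_indicator (hs i), Measure.setLIntegral_rnDeriv hPQ]

/-- Change of measure on the set where the log-likelihood ratio of a sample is at most `n * c`. -/
theorem measure_pi_le_exp_mul_add {X : Type*} [MeasurableSpace X] (P Q : Measure X)
    [IsProbabilityMeasure P] [IsProbabilityMeasure Q] (hPQ : P ≪ Q) (n : ℕ) (c : ℝ)
    {s : Set (Fin n → X)} (hs : MeasurableSet s) :
    (Measure.pi fun _ : Fin n => P) s
      ≤ ENNReal.ofReal (Real.exp (n * c)) * (Measure.pi fun _ : Fin n => Q) s
        + (Measure.pi fun _ : Fin n => P) {x | n * c < ∑ i, llr P Q (x i)} := by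
  set t : Set (Fin n → X) := {x | n * c < ∑ i, llr P Q (x i)}
  have hllr : Measurable (llr P Q) := measurable_llr P Q
  have ht : MeasurableSet t := measurableSet_lt measurable_const
    (Finset.measurable_fun_sum _ fun i _ => hllr.comp (measurable_pi_apply i))
  refine (measure_le_inter_add_sdiff _ s t).trans ?_
  rw [add_comm]
  refine add_le_add ?_ (measure_mono Set.inter_subset_right)
  have hst : MeasurableSet (s \ t) := hs.diff ht
  have htop : ∀ᵐ x ∂(Measure.pi fun _ : Fin n => Q), ∀ i, P.rnDeriv Q (x i) < ⊤ := by
    refine ae_all_iff.2 fun i => ?_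
    exact (measurePreserving_eval (fun _ : Fin n => Q) i).quasiMeasurePreserving.ae
      (Measure.rnDeriv_lt_top P Q)
  rw [Measure.pi_eq_withDensity_prod_rnDeriv P Q hPQ, withDensity_apply _ hst]
  calc ∫⁻ x in s \ t, ∏ i, P.rnDeriv Q (x i) ∂(Measure.pi fun _ : Fin n => Q)
      ≤ ∫⁻ _ in s \ t, ENNReal.ofReal (Real.exp (n * c)) ∂(Measure.pi fun _ : Fin n => Q) := by
        refine setLIntegral_mono_ae measurable_const.aemeasurable ?_
        filter_upwards [htop] with x hx hxs
        by_cases h0 : ∃ i, P.rnDeriv Q (x i) = 0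
        · obtain ⟨i, hi⟩ := h0
          rw [Finset.prod_eq_zero (Finset.mem_univ i) hi]
          exact zero_le
        · push Not at h0
          have hxt : ∑ i, llr P Q (x i) ≤ n * c := not_lt.1 hxs.2
          have e : ∀ i, P.rnDeriv Q (x i) = ENNReal.ofReal (Real.exp (llr P Q (x i))) := fun i => by
            rw [llr, Real.exp_log (ENNReal.toReal_pos (h0 i) (hx i).ne),
              ENNReal.ofReal_toReal (hx i).ne]
          simp only [e]
          rw [← ENNReal.ofReal_prod_of_nonneg fun i _ => (Real.exp_pos _).le, ← Real.exp_sum]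
          exact ENNReal.ofReal_le_ofReal (Real.exp_le_exp.2 hxt)
    _ ≤ _ := by
        rw [setLIntegral_const]
        gcongr
        exact Set.sdiff_subset

/-- One-sided weak law of large numbers for an integrable function of an i.i.d. sample. -/
theorem tendsto_measure_pi_lt_sum {X : Type*} [MeasurableSpace X] (P : Measure X)
    [IsProbabilityMeasure P] {g : X → ℝ} (hgm : Measurable g) (hg : Integrable g P) {c : ℝ}
    (hc : ∫ x, g x ∂P < c) :
    Tendsto (fun n : ℕ => (Measure.pi fun _ : Fin n => P) {x | n * c < ∑ i, g (x i)})
      atTop (𝓝 0) := by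
  set μ : Measure (ℕ → X) := Measure.infinitePi fun _ => P
  have hmp : ∀ i : ℕ, MeasurePreserving (fun ω : ℕ → X => ω i) μ P := fun i =>
    measurePreserving_eval_infinitePi (fun _ : ℕ => P) i
  have hXm : ∀ i : ℕ, Measurable fun ω : ℕ → X => g (ω i) := fun i =>
    hgm.comp (measurable_pi_apply i)
  have hind := ProbabilityTheory.iIndepFun_infinitePi (P := fun _ : ℕ => P)
    (X := fun _ x => g x) fun _ => hgm
  have hmean : ∫ ω, g (ω 0) ∂μ = ∫ x, g x ∂P := (hmp 0).integral_comp_measurable hgm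
  have hlaw := ProbabilityTheory.strong_law_ae_real (μ := μ) (fun i ω => g (ω i))
    ((hmp 0).integrable_comp_of_integrable hg) (fun i j hij => hind.indepFun hij) fun i =>
      ⟨(hXm i).aemeasurable, (hXm 0).aemeasurable, by
        rw [← Function.comp_def g, ← Function.comp_def g, ← Measure.map_map hgm (by fun_prop),
          ← Measure.map_map hgm (by fun_prop), (hmp i).map_eq, (hmp 0).map_eq]⟩
  have hmeas := tendstoInMeasure_of_tendsto_ae (fun n => (Measurable.div_const
    (Finset.measurable_fun_sum (Finset.range n) fun i _ => hXm i) (n : ℝ)).aestronglyMeasurable)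
    hlaw
  rw [tendstoInMeasure_iff_norm] at hmeas
  have hlim := hmeas (c - ∫ x, g x ∂P) (by linarith)
  refine tendsto_of_tendsto_of_tendsto_of_le_of_le' tendsto_const_nhds hlim
    (.of_forall fun _ => zero_le) ?_
  filter_upwards [eventually_gt_atTop 0] with n hn
  have hnr : (0 : ℝ) < n := by exact_mod_cast hn
  have hmap := Measure.map_infinitePi_infinitePi_of_inj (P := fun _ : ℕ => P)
    (f := fun i : Fin n => (i : ℕ)) Fin.val_injective
  rw [Measure.infinitePi_eq_pi (ι := Fin n)] at hmap
  have hs : MeasurableSet {x : Fin n → X | n * c < ∑ i, g (x i)} := measurableSet_lt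
    measurable_const (Finset.measurable_fun_sum _ fun i _ => hgm.comp (measurable_pi_apply i))
  rw [← hmap, Measure.map_apply (by fun_prop) hs]
  refine measure_mono fun ω hω => ?_
  simp only [Set.mem_preimage, Set.mem_ofPred_eq] at hω ⊢
  rw [Fin.sum_univ_eq_sum_range (fun i => g (ω i)) n, mul_comm, ← lt_div_iff₀ hnr] at hω
  rw [hmean]
  exact le_trans (by linarith) (le_abs_self _)

theorem le_expRate {n : ℕ} (hn : 0 < n) {p : ℝ≥0∞} {r : ℝ}
    (hp : p ≤ ENNReal.ofReal (Real.exp (-(n * r)))) : (r : EReal) ≤ expRate n p := by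
  have hnr : (0 : ℝ) < n := by exact_mod_cast hn
  have h := ENNReal.log_le_log hp
  rw [ENNReal.log_ofReal_of_pos (Real.exp_pos _), Real.log_exp] at h
  have h2 := mul_le_mul_of_nonneg_left h
    (show (0 : EReal) ≤ (((n : ℝ)⁻¹ : ℝ) : EReal) by exact_mod_cast (inv_pos.2 hnr).le)
  rw [expRate, EReal.le_neg]
  refine h2.trans_eq ?_
  rw [← EReal.coe_mul, ← EReal.coe_neg]
  congr 1
  field_simp

theorem expRate_le {n : ℕ} (hn : 0 < n) {p : ℝ≥0∞} {r : ℝ}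
    (hp : ENNReal.ofReal (Real.exp (-(n * r))) ≤ p) : expRate n p ≤ (r : EReal) := by
  have hnr : (0 : ℝ) < n := by exact_mod_cast hn
  have h := ENNReal.log_le_log hp
  rw [ENNReal.log_ofReal_of_pos (Real.exp_pos _), Real.log_exp] at h
  have h2 := mul_le_mul_of_nonneg_left h
    (show (0 : EReal) ≤ (((n : ℝ)⁻¹ : ℝ) : EReal) by exact_mod_cast (inv_pos.2 hnr).le)
  rw [expRate, EReal.neg_le]
  refine le_trans (le_of_eq ?_) h2
  rw [← EReal.coe_mul, ← EReal.coe_neg]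
  congr 1
  field_simp

theorem liminf_expRate_eq {p : ℕ → ℝ≥0∞} {d : ℝ}
    (hle : ∀ r < d, ∀ᶠ n : ℕ in atTop, p n ≤ ENNReal.ofReal (Real.exp (-(n * r))))
    (hge : ∀ r > d, ∀ᶠ n : ℕ in atTop, ENNReal.ofReal (Real.exp (-(n * r))) ≤ p n) :
    liminf (fun n => expRate n (p n)) atTop = (d : EReal) := by
  refine le_antisymm (le_of_forall_gt_imp_ge_of_dense fun a ha => ?_)
    (le_of_forall_lt_imp_le_of_dense fun a ha => ?_)
  · obtain ⟨r, hr, hra⟩ := EReal.lt_iff_exists_real_btwn.1 ha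
    refine le_trans ?_ hra.le
    refine liminf_le_of_frequently_le' (Eventually.frequently ?_)
    filter_upwards [hge r (by exact_mod_cast hr), eventually_gt_atTop 0] with n h hn
    exact expRate_le hn h
  · obtain ⟨r, har, hr⟩ := EReal.lt_iff_exists_real_btwn.1 ha
    refine har.le.trans ?_
    refine le_liminf_of_le (by isBoundedDefault) ?_
    filter_upwards [hle r (by exact_mod_cast hr), eventually_gt_atTop 0] with n h hn
    exact le_expRate hn h

namespace IsBddKernel

variable {X : Type*} [MeasurableSpace X] [TopologicalSpace X] [SecondCountableTopology X]
  [BorelSpace X] {k : X → X → ℝ} {K : ℝ}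

theorem measurable_duSqTwo (hk : IsBddKernel k K) (M N : ℕ) :
    Measurable fun p : (Fin M → X) × (Fin N → X) => duSqTwo k p.1 p.2 := by
  have h : ∀ f g : (Fin M → X) × (Fin N → X) → X, Measurable f → Measurable g →
      Measurable fun p => k (f p) (g p) := fun f g hf hg =>
    hk.measurable_uncurry.comp (hf.prodMk hg)
  have hy : ∀ i, Measurable fun p : (Fin M → X) × (Fin N → X) => p.1 i := fun i => by fun_prop
  have hx : ∀ i, Measurable fun p : (Fin M → X) × (Fin N → X) => p.2 i := fun i => by fun_prop
  unfold duSqTwo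
  refine ((Measurable.const_mul ?_ _).add (Measurable.const_mul ?_ _)).sub
    (Measurable.const_mul ?_ _) <;>
  refine Finset.measurable_fun_sum _ fun i _ => Finset.measurable_fun_sum _ fun j _ => ?_
  · exact h _ _ (hy i) (hy j)
  · exact h _ _ (hx i) (hx j)
  · exact h _ _ (hx i) (hy j)

variable [T2Space X] [Nonempty X]

/-- The type-I error of the unbiased two-sample MMD test. -/
theorem measure_prod_lt_duSqTwo_le (hk : IsBddKernel k K) (hK : 0 < K)
    (h_tri : ∀ R S T : ProbabilityMeasure X, mmd k (R : Measure X) (T : Measure X)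
      ≤ mmd k (R : Measure X) (S : Measure X) + mmd k (S : Measure X) (T : Measure X))
    (P : ProbabilityMeasure X) {M N : ℕ} (hM : 2 ≤ M) (hN : 2 ≤ N) {α : ℝ} (hα0 : 0 < α)
    (hα1 : α < 1) :
    (Measure.pi (fun _ : Fin M => (P : Measure X))).prod
        (Measure.pi (fun _ : Fin N => (P : Measure X)))
        {p | ((Real.sqrt (K / M) + Real.sqrt (K / N)) * (2 + Real.sqrt (2 * Real.log (2 / α)))) ^ 2
          + K / M + K / N < duSqTwo k p.1 p.2} ≤ ENNReal.ofReal α := by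
  set s := Real.sqrt (2 * Real.log (2 / α)) with hs
  have hlog : 0 < Real.log (2 / α) := Real.log_pos (by rw [lt_div_iff₀ hα0]; linarith)
  have hs0 : 0 ≤ s := Real.sqrt_nonneg _
  have hs2 : s ^ 2 = 2 * Real.log (2 / α) := Real.sq_sqrt (by positivity)
  have htail : ∀ L : ℕ, 2 ≤ L → (Measure.pi fun _ : Fin L => (P : Measure X))
      {z | Real.sqrt (K / L) * (1 + (1 + s)) ≤ mmd k P (empMeas L z)}
        ≤ ENNReal.ofReal (α / 2) := by
    intro L hL
    refine (hk.measure_mmd_empMeas_gt_le hK h_tri P (by lia) (by positivity)).trans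
      (ENNReal.ofReal_le_ofReal ?_)
    rw [← Real.exp_log (show 0 < α / 2 by positivity), Real.exp_le_exp,
      show α / 2 = (2 / α)⁻¹ by rw [inv_div], Real.log_inv]
    nlinarith
  set A : Set (Fin M → X) := {z | Real.sqrt (K / M) * (1 + (1 + s)) ≤ mmd k P (empMeas M z)}
  set B : Set (Fin N → X) := {z | Real.sqrt (K / N) * (1 + (1 + s)) ≤ mmd k P (empMeas N z)}
  refine (measure_mono (t := A ×ˢ Set.univ ∪ Set.univ ×ˢ B) fun p hp => ?_).trans ?_
  · rw [Set.mem_ofPred_eq] at hp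
    by_contra hAB
    simp only [Set.mem_union, Set.mem_prod, Set.mem_univ, and_true, true_and, not_or] at hAB
    have hA : mmd k P (empMeas M p.1) < _ := not_le.1 hAB.1
    have hB : mmd k P (empMeas N p.2) < _ := not_le.1 hAB.2
    have h1 := (abs_le.1 (hk.abs_duSqTwo_sub_mmdSq_le hM hN p.1 p.2)).2
    have h2 : _ < mmd k (empMeas M p.1 : Measure X) (empMeas N p.2) :=
      (Real.lt_sqrt (by positivity)).2 (show ((Real.sqrt (K / M) + Real.sqrt (K / N)) * (2 + s)) ^ 2
        < mmdSq k (empMeas M p.1 : Measure X) (empMeas N p.2) by linarith)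
    have h3 := h_tri (empMeas M p.1) P (empMeas N p.2)
    rw [hk.mmd_comm (empMeas M p.1 : Measure X) P] at h3
    linarith
  · refine (measure_union_le _ _).trans ?_
    rw [Measure.prod_prod, Measure.prod_prod, measure_univ, measure_univ, mul_one, one_mul]
    refine (add_le_add (htail M hM) (htail N hN)).trans_eq ?_
    rw [← ENNReal.ofReal_add (by positivity) (by positivity), add_halves]

/-- The empirical measure of a sample of size `m n`, with `m n / n → ∞`, converges
superexponentially fast in `n`. -/
theorem eventually_measure_le_mmd_empMeas_le (hk : IsBddKernel k K) (hK : 0 < K)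
    (h_tri : ∀ R S T : ProbabilityMeasure X, mmd k (R : Measure X) (T : Measure X)
      ≤ mmd k (R : Measure X) (S : Measure X) + mmd k (S : Measure X) (T : Measure X))
    (P : ProbabilityMeasure X) {m : ℕ → ℕ}
    (hmn : Tendsto (fun n : ℕ => (m n : ℝ) / n) atTop atTop) {δ : ℝ} (hδ : 0 < δ) (r : ℝ) :
    ∀ᶠ n : ℕ in atTop, (Measure.pi fun _ : Fin (m n) => (P : Measure X))
      {z | δ ≤ mmd k P (empMeas (m n) z)} ≤ ENNReal.ofReal (Real.exp (-(n * r))) := by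
  have hlim : Tendsto (fun n : ℕ => Real.sqrt (K * ((m n : ℝ) / n)⁻¹) * (1 + Real.sqrt |r|))
      atTop (𝓝 0) := by
    have := (((tendsto_inv_atTop_zero.comp hmn).const_mul K).sqrt).mul_const (1 + Real.sqrt |r|)
    simpa using this
  filter_upwards [hlim.eventually (gt_mem_nhds hδ), hmn.eventually_ge_atTop 1,
    eventually_gt_atTop 0] with n hn hm hn0
  have hnr : (1 : ℝ) ≤ n := by exact_mod_cast hn0
  have hm0 : 0 < m n := by
    rw [le_div_iff₀ (by linarith)] at hm
    exact_mod_cast (show (0 : ℝ) < m n by linarith)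
  have h := hk.measure_mmd_empMeas_gt_le hK h_tri P hm0 (Real.sqrt_nonneg (n * |r|))
  rw [Real.sq_sqrt (by positivity)] at h
  refine (measure_mono fun z hz => ?_).trans (h.trans (ENNReal.ofReal_le_ofReal
    (Real.exp_le_exp.2 (neg_le_neg (mul_le_mul_of_nonneg_left (le_abs_self r) (by linarith))))))
  rw [Set.mem_ofPred_eq] at hz ⊢
  refine le_trans ?_ (hn.le.trans hz)
  have e : K * ((m n : ℝ) / n)⁻¹ = K / m n * n := by rw [inv_div]; ring
  rw [e, Real.sqrt_mul (by positivity), Real.sqrt_mul (by positivity), mul_assoc]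
  have h1 : 1 ≤ Real.sqrt n := Real.one_le_sqrt.2 hnr
  gcongr
  linarith

/-- The type-II error exponent of the unbiased two-sample MMD test is at least `D(P‖Q)`. -/
theorem eventually_measure_prod_duSqTwo_le_le (hk : IsBddKernel k K) (hK : 0 < K)
    (h_tri : ∀ R S T : ProbabilityMeasure X, mmd k (R : Measure X) (T : Measure X)
      ≤ mmd k (R : Measure X) (S : Measure X) + mmd k (S : Measure X) (T : Measure X))
    (h_nhds : ∀ s : Set (ProbabilityMeasure X), IsOpen s → ∀ R ∈ s, ∃ ε > 0,
      ∀ S : ProbabilityMeasure X, mmd k (S : Measure X) (R : Measure X) < ε → S ∈ s)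
    [TopologicalSpace.IsCompletelyMetrizableSpace X] (P Q : ProbabilityMeasure X)
    (hPQ : (P : Measure X) ≪ Q)
    (hllr_int : Integrable (llr (P : Measure X) Q) P) {m : ℕ → ℕ}
    (hmn : Tendsto (fun n : ℕ => (m n : ℝ) / n) atTop atTop) {τ : ℕ → ℝ}
    (hτ : Tendsto τ atTop (𝓝 0)) {r : ℝ} (hr : r < ∫ x, llr (P : Measure X) Q x ∂P) :
    ∀ᶠ n : ℕ in atTop, (Measure.pi (fun _ : Fin (m n) => (P : Measure X))).prod
        (Measure.pi (fun _ : Fin n => (Q : Measure X))) {p | mmdSq k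
          (empMeas (m n) p.1 : Measure X) (empMeas n p.2) ≤ τ n}
      ≤ ENNReal.ofReal (Real.exp (-(n * r))) := by
  obtain ⟨r', hrr', hr'⟩ := exists_between hr
  obtain ⟨g, hg⟩ := exists_boundedContinuous_lt_integral_sub_log (P : Measure X) Q hPQ hllr_int hr'
  set c : ℝ := r' + Real.log (∫ x, Real.exp (g x) ∂Q) with hc
  obtain ⟨δ, hδ, hδc⟩ := h_nhds {S | c < ∫ x, g x ∂S}
    (isOpen_lt continuous_const
      (ProbabilityMeasure.continuous_integral_boundedContinuousFunction g)) P
    (show c < ∫ x, g x ∂(P : Measure X) by linarith)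
  have hgi : Integrable (fun x => Real.exp (g x)) (Q : Measure X) :=
    Integrable.of_bound (Real.continuous_exp.comp g.continuous).measurable.aestronglyMeasurable
      (Real.exp ‖g‖) (.of_forall fun x => by
        rw [Real.norm_eq_abs, Real.abs_exp]
        exact Real.exp_le_exp.2 ((le_abs_self _).trans (g.norm_coe_le_norm x)))
  have hexp : ∀ᶠ n : ℕ in atTop, Real.log 2 ≤ n * (r' - r) :=
    (tendsto_natCast_atTop_atTop.atTop_mul_const (sub_pos.2 hrr')).eventually_ge_atTop _
  filter_upwards [hk.eventually_measure_le_mmd_empMeas_le hK h_tri P hmn (half_pos hδ) r', hexp,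
    hτ.eventually (gt_mem_nhds (show 0 < (δ / 2) ^ 2 by positivity)),
    eventually_gt_atTop 0] with n hn hn2 hτn hn0
  set A : Set (Fin (m n) → X) := {z | δ / 2 ≤ mmd k P (empMeas (m n) z)}
  set B : Set (Fin n → X) := {x | n * c ≤ ∑ i, g (x i)}
  have hB := measure_pi_le_sum_le (Q : Measure X) g hgi n c
  rw [hc, add_sub_cancel_right, ← hc] at hB
  refine (measure_mono (t := A ×ˢ Set.univ ∪ Set.univ ×ˢ B) fun p hp => ?_).trans ?_
  · rw [Set.mem_ofPred_eq] at hp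
    simp only [Set.mem_union, Set.mem_prod, Set.mem_univ, and_true, true_and]
    refine or_iff_not_imp_left.2 fun hA => ?_
    have hA : mmd k P (empMeas (m n) p.1) < δ / 2 := not_le.1 hA
    have h1 : mmd k (empMeas (m n) p.1 : Measure X) (empMeas n p.2) < δ / 2 :=
      (Real.sqrt_lt' (by positivity)).2 (hp.trans_lt hτn)
    have h2 := h_tri P (empMeas (m n) p.1) (empMeas n p.2)
    have h3 := hδc (empMeas n p.2) (by rw [hk.mmd_comm]; linarith)
    rw [Set.mem_ofPred_eq, integral_empMeas hn0, lt_inv_mul_iff₀ (by exact_mod_cast hn0)] at h3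
    exact h3.le
  · refine (measure_union_le _ _).trans ?_
    rw [Measure.prod_prod, Measure.prod_prod, measure_univ, measure_univ, mul_one, one_mul]
    refine (add_le_add hn hB).trans ?_
    rw [← ENNReal.ofReal_add (by positivity) (by positivity), ← two_mul]
    refine ENNReal.ofReal_le_ofReal ?_
    nth_rewrite 1 [← Real.exp_log two_pos]
    rw [← Real.exp_add, Real.exp_le_exp]
    linarith

end IsBddKernel

/-- The converse half of Stein's lemma: a test of asymptotic power bounded below under `P`
has exponent at most `D(P‖Q)` under `Q`. -/
theorem eventually_exp_le_measure_prod {X : Type*} [MeasurableSpace X]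
    (P Q : Measure X) [IsProbabilityMeasure P] [IsProbabilityMeasure Q] (hPQ : P ≪ Q)
    (hllr_int : Integrable (llr P Q) P) {Ω : ℕ → Type*} [∀ n, MeasurableSpace (Ω n)]
    (μ : ∀ n, Measure (Ω n)) [∀ n, IsProbabilityMeasure (μ n)]
    {A : ∀ n, Set (Ω n × (Fin n → X))} (hA : ∀ n, MeasurableSet (A n)) {β : ℝ≥0∞} (hβ : β ≠ 0)
    (hAβ : ∀ᶠ n : ℕ in atTop, β ≤ (μ n).prod (Measure.pi fun _ : Fin n => P) (A n))
    {r : ℝ} (hr : ∫ x, llr P Q x ∂P < r) :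
    ∀ᶠ n : ℕ in atTop, ENNReal.ofReal (Real.exp (-(n * r)))
      ≤ (μ n).prod (Measure.pi fun _ : Fin n => Q) (A n) := by
  obtain ⟨c, hc, hcr⟩ := exists_between hr
  have hlim := tendsto_measure_pi_lt_sum P (measurable_llr P Q) hllr_int hc
  have hexp : Tendsto (fun n : ℕ => ENNReal.ofReal (Real.exp (-(n * (r - c))))) atTop (𝓝 0) := by
    rw [← ENNReal.ofReal_zero]
    refine ENNReal.tendsto_ofReal (Real.tendsto_exp_neg_atTop_nhds_zero.comp ?_)
    exact tendsto_natCast_atTop_atTop.atTop_mul_const (sub_pos.2 hcr)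
  have hsum := hlim.add hexp
  rw [add_zero] at hsum
  filter_upwards [hAβ, hsum.eventually (gt_mem_nhds (pos_iff_ne_zero.2 hβ))] with n h1 h2
  set e : ℝ≥0∞ := ENNReal.ofReal (Real.exp (n * c)) with he
  have h3 : (μ n).prod (Measure.pi fun _ : Fin n => P) (A n)
      ≤ e * (μ n).prod (Measure.pi fun _ : Fin n => Q) (A n)
        + (Measure.pi fun _ : Fin n => P) {x | n * c < ∑ i, llr P Q (x i)} := by
    rw [Measure.prod_apply (hA n), Measure.prod_apply (hA n),
      ← lintegral_const_mul _ (measurable_measure_prodMk_left (hA n))]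
    refine (lintegral_mono fun ω => measure_pi_le_exp_mul_add P Q hPQ n c
      (measurable_prodMk_left (hA n))).trans_eq ?_
    rw [lintegral_add_right _ measurable_const, lintegral_const, measure_univ, mul_one]
  have h4 := h2.trans_le (h1.trans h3)
  rw [add_comm] at h4
  have h5 := lt_of_add_lt_add_right h4
  have e1 : ENNReal.ofReal (Real.exp (-(n * (r - c))))
      = e * ENNReal.ofReal (Real.exp (-(n * r))) := by
    rw [he, ← ENNReal.ofReal_mul (Real.exp_pos _).le, ← Real.exp_add]
    ring_nf
  rw [e1] at h5
  exact (ENNReal.mul_le_mul_iff_right (by simp [Real.exp_pos]) ENNReal.ofReal_ne_top).1 h5.le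

/-- The unbiased quadratic-time MMD two-sample test
`d_u²(P̂_m, Q̂_n) ≤ γ_{m,n}² + K/m + K/n` with
`γ_{m,n} = (sqrt(K/m) + sqrt(K/n))(2 + sqrt(2 log(2/α)))` and `m = m(n)` samples from `P`
with `m(n)/n → ∞`: under `H₀ : Q = P` its type-I error probability is at most `α` for all
`m, n ≥ 2`, and under `H₁` with `0 < D(P‖Q) < ∞` its type-II error exponent (in `n`)
equals `D(P‖Q)`. -/
theorem mmd_unbiased_two_sample_test_optimal {X : Type*} [MeasurableSpace X]
    [TopologicalSpace X] [PolishSpace X] [LocallyCompactSpace X] [T2Space X] [BorelSpace X]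
    [Nonempty X]
    (k : X → X → ℝ) (hk_cont : Continuous fun p : X × X => k p.1 p.2)
    (hk_symm : ∀ x y, k x y = k y x)
    (hk_psd : ∀ (N : ℕ) (z : Fin N → X) (c : Fin N → ℝ),
      0 ≤ ∑ i, ∑ j, c i * c j * k (z i) (z j))
    (K : ℝ) (hK : 0 < K) (hk_bdd : ∀ x y, k x y ∈ Set.Icc (0 : ℝ) K)
    (h_sep : ∀ R S : ProbabilityMeasure X,
      mmd k (R : Measure X) (S : Measure X) = 0 ↔ R = S)
    (h_tri : ∀ R S T : ProbabilityMeasure X,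
      mmd k (R : Measure X) (T : Measure X)
        ≤ mmd k (R : Measure X) (S : Measure X) + mmd k (S : Measure X) (T : Measure X))
    (h_metrize : ∀ s : Set (ProbabilityMeasure X),
      IsOpen s ↔ ∀ R ∈ s, ∃ ε > 0,
        ∀ S : ProbabilityMeasure X, mmd k (S : Measure X) (R : Measure X) < ε → S ∈ s)
    (P Q : ProbabilityMeasure X) {α : ℝ} (hα0 : 0 < α) (hα1 : α < 1)
    (m : ℕ → ℕ) (hmn : Tendsto (fun n : ℕ => (m n : ℝ) / n) atTop atTop)
    (γ : ℕ → ℕ → ℝ)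
    (hγ : ∀ m' n : ℕ, γ m' n = (Real.sqrt (K / m') + Real.sqrt (K / n)) *
      (2 + Real.sqrt (2 * Real.log (2 / α)))) :
    (Q = P → ∀ m' n : ℕ, 2 ≤ m' → 2 ≤ n →
      (Measure.pi (fun _ : Fin m' => (P : Measure X))).prod
          (Measure.pi (fun _ : Fin n => (P : Measure X)))
          {p : (Fin m' → X) × (Fin n → X) |
            γ m' n ^ 2 + K / m' + K / n < duSqTwo k p.1 p.2}
        ≤ ENNReal.ofReal α)
    ∧ (0 < klDiv (P : Measure X) (Q : Measure X) →
        klDiv (P : Measure X) (Q : Measure X) < ⊤ →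
        liminf (fun n : ℕ => expRate n
            ((Measure.pi (fun _ : Fin (m n) => (P : Measure X))).prod
              (Measure.pi (fun _ : Fin n => (Q : Measure X)))
              {p : (Fin (m n) → X) × (Fin n → X) |
                duSqTwo k p.1 p.2 ≤ γ (m n) n ^ 2 + K / m n + K / n})) atTop
          = ((klDiv (P : Measure X) (Q : Measure X) : ℝ≥0∞) : EReal)) := by
  have hk : IsBddKernel k K := ⟨hk_cont, hk_symm, hk_psd, hk_bdd⟩
  have typeI : ∀ m' n : ℕ, 2 ≤ m' → 2 ≤ n →
      (Measure.pi (fun _ : Fin m' => (P : Measure X))).prod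
          (Measure.pi (fun _ : Fin n => (P : Measure X)))
          {p : (Fin m' → X) × (Fin n → X) |
            γ m' n ^ 2 + K / m' + K / n < duSqTwo k p.1 p.2}
        ≤ ENNReal.ofReal α := by
    intro m' n hm hn
    simp only [hγ]
    exact hk.measure_prod_lt_duSqTwo_le hK h_tri P hm hn hα0 hα1
  refine ⟨fun _ => typeI, fun _ hD => ?_⟩
  have hfin : (P : Measure X) ≪ Q ∧ Integrable (llr (P : Measure X) Q) P := by
    by_contra h
    rw [klDiv, if_neg h] at hD
    exact hD.ne rfl
  have hD0 : 0 ≤ ∫ x, llr (P : Measure X) Q x ∂P := by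
    rw [← InformationTheory.toReal_klDiv_of_measure_eq hfin.1 (by simp)]
    exact ENNReal.toReal_nonneg
  rw [klDiv, if_pos hfin, EReal.coe_ennreal_ofReal, max_eq_left hD0]
  have hm : Tendsto m atTop atTop := by
    refine tendsto_atTop_mono' atTop ?_ tendsto_id
    filter_upwards [hmn.eventually_ge_atTop 1, eventually_gt_atTop 0] with n h1 h0
    rw [le_div_iff₀ (by exact_mod_cast h0), one_mul] at h1
    exact_mod_cast h1
  refine liminf_expRate_eq (fun r hr => ?_) fun r hr => ?_
  · have hKn : Tendsto (fun n : ℕ => K / n) atTop (𝓝 0) := tendsto_const_div_atTop_nhds_zero_nat K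
    have hKm : Tendsto (fun n : ℕ => K / m n) atTop (𝓝 0) := hKn.comp hm
    have hτ : Tendsto (fun n : ℕ => γ (m n) n ^ 2 + 2 * (K / m n) + 2 * (K / n)) atTop (𝓝 0) := by
      simp only [hγ]
      have := ((((hKm.sqrt.add hKn.sqrt).mul_const
        (2 + Real.sqrt (2 * Real.log (2 / α)))).pow 2).add (hKm.const_mul 2)).add (hKn.const_mul 2)
      simpa using this
    filter_upwards [hk.eventually_measure_prod_duSqTwo_le_le hK h_tri
      (fun s hs => (h_metrize s).1 hs) P Q hfin.1 hfin.2 hmn hτ hr, eventually_ge_atTop 2,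
      hm.eventually_ge_atTop 2] with n h hn hmn2
    refine (measure_mono fun p hp => ?_).trans h
    rw [Set.mem_ofPred_eq] at hp ⊢
    linarith [(abs_le.1 (hk.abs_duSqTwo_sub_mmdSq_le hmn2 hn p.1 p.2)).1]
  · refine eventually_exp_le_measure_prod (P : Measure X) Q hfin.1 hfin.2
      (fun n => Measure.pi fun _ : Fin (m n) => (P : Measure X))
      (fun n => measurableSet_le (hk.measurable_duSqTwo (m n) n) measurable_const)
      (β := ENNReal.ofReal (1 - α)) (by simpa using hα1) ?_ hr
    filter_upwards [eventually_ge_atTop 2, hm.eventually_ge_atTop 2] with n hn hmn2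
    rw [ENNReal.ofReal_sub _ hα0.le, ENNReal.ofReal_one, tsub_le_iff_right]
    refine le_trans ?_ (add_le_add_right (typeI (m n) n hmn2 hn) _)
    rw [← measure_univ (μ := (Measure.pi (fun _ : Fin (m n) => (P : Measure X))).prod
      (Measure.pi (fun _ : Fin n => (P : Measure X))))]
    refine (measure_mono fun p _ => ?_).trans (measure_union_le _ _)
    exact le_or_gt (duSqTwo k p.1 p.2) _
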